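/- arXiv:1205.4884 — 2 statements merged into one kernel-verified Lean document; each statement's English description precedes it below -/
import Mathlib

section
/- Let G be a finitely generated group, n a natural number, and ρ : G → GL(n, ℂ) a group homomorphism. Then there exists a subring A of ℂ which is finitely generated as a ℤ-algebra such that for every g ∈ G every matrix entry of ρ(g) lies in A (so that ρ factors through the subgroup GL(n, A) of GL(n, ℂ)). -/
/-- If `G` is a finitely generated group and `ρ : G → GL(n, ℂ)` is a group
homomorphism, then there is a subring `A ⊆ ℂ` which is finitely generated as a
`ℤ`-algebra such that every matrix entry of every `ρ g` lies in `A`. -/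
theorem stmt0 (G : Type) [Group G] [Group.FG G] (n : ℕ)
    (ρ : G →* Matrix.GeneralLinearGroup (Fin n) ℂ) :
    ∃ A : Subring ℂ, Algebra.FiniteType ℤ A ∧
      ∀ g : G, ∀ i j : Fin n, (ρ g : Matrix (Fin n) (Fin n) ℂ) i j ∈ A := by
  obtain ⟨S, hS, hfin⟩ := (Monoid.fg_iff (M := G)).1 inferInstance
  let T : Set ℂ := (fun p : G × Fin n × Fin n =>
    (ρ p.1 : Matrix (Fin n) (Fin n) ℂ) p.2.1 p.2.2) '' (S ×ˢ Set.univ)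
  have hT : T.Finite := (hfin.prod Set.finite_univ).image _
  have hFG : Algebra.FiniteType ℤ (Algebra.adjoin ℤ T) :=
    (Subalgebra.fg_iff_finiteType _).1 (Subalgebra.fg_def.2 ⟨T, hT, rfl⟩)
  refine ⟨(Algebra.adjoin ℤ T).toSubring, ?_, ?_⟩
  · let f : Algebra.adjoin ℤ T →+* (Algebra.adjoin ℤ T).toSubring :=
      { toFun := fun x => ⟨x.1, x.2⟩
        map_one' := rfl
        map_mul' := fun _ _ => rfl
        map_zero' := rfl
        map_add' := fun _ _ => rfl }
    let φ : Algebra.adjoin ℤ T →ₐ[ℤ] (Algebra.adjoin ℤ T).toSubring :=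
      { f with commutes' := fun r => by
                 apply Subtype.ext
                 simp [f] }
    exact Algebra.FiniteType.of_surjective φ (fun y => ⟨⟨y.1, y.2⟩, rfl⟩)
  · intro g
    have hg : g ∈ Submonoid.closure S := hS ▸ Submonoid.mem_top g
    induction hg using Submonoid.closure_induction with
    | mem x hx =>
      intro i j
      exact Algebra.subset_adjoin ⟨(x, i, j), ⟨hx, Set.mem_univ _⟩, rfl⟩
    | one =>
      intro i j
      rw [map_one, Units.val_one, Matrix.one_apply]
      split_ifs
      · exact one_mem _
      · exact zero_mem _
    | mul x y _ _ hx hy =>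
      intro i j
      rw [map_mul, Units.val_mul, Matrix.mul_apply]
      exact sum_mem fun k _ => mul_mem (hx i k) (hy k j)
end

section
/- Every field which is finitely generated as a ℤ-algebra (that is, finitely generated as a commutative ring) is a finite field. -/
theorem int_isJacobsonRing_aux : IsJacobsonRing ℤ := by
  rw [isJacobsonRing_iff_prime_eq]
  intro P hP
  by_cases h : P = ⊥
  · subst h
    rw [eq_bot_iff]
    intro x hx
    have h1 := Ideal.mem_jacobson_bot.1 hx x
    rw [Int.isUnit_iff] at h1
    rw [Ideal.mem_bot]
    rcases h1 with h1 | h1 <;> nlinarith [mul_self_nonneg x, mul_self_eq_zero.1 (show x * x = 0 by nlinarith [mul_self_nonneg x])]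
  · exact Ideal.jacobson_eq_self_of_isMaximal (H := hP.isMaximal h)

/-- Every field which is finitely generated as a `ℤ`-algebra is finite. -/
theorem stmt1 (K : Type) [Field K] (h : Algebra.FiniteType ℤ K) : Finite K := by
  have := int_isJacobsonRing_aux
  have hf : Module.Finite ℤ K := finite_of_finite_type_of_isJacobsonRing ℤ K
  obtain ⟨p, hp⟩ := CharP.exists K
  rcases Nat.eq_zero_or_pos p with rfl | hpos
  · exfalso
    have : CharZero K := CharP.charP_to_charZero K
    have hinj : Function.Injective (algebraMap ℤ K) := by
      simpa using (Int.cast_injective (α := K))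
    exact Int.not_isField (isField_of_isIntegral_of_isField hinj (Field.toIsField K))
  · refine Module.finite_of_fg_torsion K fun x => ?_
    refine ⟨⟨(p : ℤ), mem_nonZeroDivisors_of_ne_zero (by exact_mod_cast hpos.ne')⟩, ?_⟩
    change (p : ℤ) • x = 0
    simp
end
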